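/- Let R be a commutative ring with elements e_0, e_1, e_2, … and h_0, h_1, h_2, … satisfying e_0 = h_0 = 1 and Σ_{m=0}^{j} (−1)^m e_m h_{j−m} = 0 for every j ≥ 1. For integers n ≥ 1 and 0 ≤ k ≤ n − 1, let a be the hook composition (k+1, 1, 1, …, 1) of n (with n − k − 1 parts equal to 1). Then Ψ(a) = s_{k+1, 1^{n−k−1}}, where s_{k+1,1^{n−k−1}} = Σ_{j=0}^{n−k−1} (−1)^j e_{n−k−1−j} h_{k+1+j}. -/

import Mathlib

/-- A composition of `n`: a list of positive integers summing to `n`. -/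
def IsComposition (n : ℕ) (a : List ℕ) : Prop :=
  (∀ x ∈ a, 0 < x) ∧ a.sum = n

/-- `b` is a coarsening of `a`: `b` is obtained by summing consecutive nonempty blocks of `a`. -/
def Coarsen (a b : List ℕ) : Prop :=
  ∃ L : List (List ℕ), (∀ l ∈ L, l ≠ []) ∧ L.flatten = a ∧ b = L.map List.sum

/-- `Ψ(a) = Σ_{a ⪯ b} (−1)^{l(b)−l(a)} h_{b_1} ⋯ h_{b_{l(b)}}`, summed over all
coarsenings `b` of `a` (a finite set).  Since `l(b) ≤ l(a)`, the sign
`(−1)^{l(b)−l(a)}` equals `(−1)^{l(a)−l(b)}`. -/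
noncomputable def Psi {R : Type*} [CommRing R] (h : ℕ → R) (a : List ℕ) : R :=
  ∑ᶠ b ∈ {b : List ℕ | Coarsen a b},
    (-1 : R) ^ (a.length - b.length) * (b.map h).prod

theorem Coarsen.exists_head {a : ℕ} {t b : List ℕ} (H : Coarsen (a :: t) b) :
    ∃ c b', b = c :: b' ∧ a ≤ c := by
  obtain ⟨L, hL, hf, rfl⟩ := H
  match L, hL, hf with
  | [] :: _, hL, _ => simp at hL
  | (x :: l) :: L, _, hf =>
    simp only [List.flatten_cons, List.cons_append, List.cons.injEq] at hf
    exact ⟨_, _, List.map_cons, by simp [hf.1]⟩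

theorem coarsen_singleton_iff {a : ℕ} {b : List ℕ} : Coarsen [a] b ↔ b = [a] := by
  constructor
  · rintro ⟨L, hL, hf, rfl⟩
    match L, hL, hf with
    | [] :: _, hL, _ => simp at hL
    | [x :: l], _, hf => simp_all
    | (_ :: _) :: [] :: _, hL, _ => simp at hL
    | (_ :: _) :: (_ :: _) :: _, _, hf => simp at hf
  · rintro rfl
    exact ⟨[[a]], by simp, by simp, by simp⟩

theorem coarsen_cons_cons_iff {a a' : ℕ} {t b : List ℕ} :
    Coarsen (a :: a' :: t) b ↔
      (∃ b', Coarsen (a' :: t) b' ∧ a :: b' = b) ∨ Coarsen ((a + a') :: t) b := by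
  constructor
  · rintro ⟨L, hL, hf, rfl⟩
    match L, hL, hf with
    | [] :: _, hL, _ => simp at hL
    | [x] :: L, hL, hf =>
      simp only [List.flatten_cons, List.cons_append, List.nil_append, List.cons.injEq] at hf
      exact .inl ⟨_, ⟨L, fun l hl => hL l (by simp [hl]), hf.2, rfl⟩, by simp [hf.1]⟩
    | (x :: y :: l) :: L, hL, hf =>
      simp only [List.flatten_cons, List.cons_append, List.cons.injEq] at hf
      obtain ⟨rfl, rfl, rfl⟩ := hf
      exact .inr ⟨((x + y) :: l) :: L, by simpa using hL, by simp, by simp [add_assoc]⟩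
  · rintro (⟨_, ⟨L, hL, hf, rfl⟩, rfl⟩ | ⟨L, hL, hf, rfl⟩)
    · exact ⟨[a] :: L, by simpa using hL, by simp [hf], by simp⟩
    · match L, hL, hf with
      | [] :: _, hL, _ => simp at hL
      | (x :: l) :: L, hL, hf =>
        simp only [List.flatten_cons, List.cons_append, List.cons.injEq] at hf
        obtain ⟨rfl, rfl⟩ := hf
        exact ⟨(a :: a' :: l) :: L, by simpa using hL, by simp, by simp [add_assoc]⟩

theorem setOf_coarsen_cons_cons (a a' : ℕ) (t : List ℕ) :
    {b | Coarsen (a :: a' :: t) b} =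
      (List.cons a '' {b | Coarsen (a' :: t) b}) ∪ {b | Coarsen ((a + a') :: t) b} :=
  Set.ext fun _ => coarsen_cons_cons_iff

theorem finite_setOf_coarsen_cons (a : ℕ) (t : List ℕ) : {b | Coarsen (a :: t) b}.Finite := by
  induction t generalizing a with
  | nil => simp [coarsen_singleton_iff]
  | cons a' t ih =>
    rw [setOf_coarsen_cons_cons]
    exact ((ih a').image _).union (ih _)

theorem Coarsen.length_le {a b : List ℕ} (H : Coarsen a b) : b.length ≤ a.length := by
  obtain ⟨L, hL, rfl, rfl⟩ := H
  induction L with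
  | nil => simp
  | cons l L ih =>
    have h1 := List.length_pos_iff.2 (hL l (by simp))
    have h2 := ih fun l hl => hL l (by simp [hl])
    simp only [List.map_cons, List.length_cons, List.flatten_cons, List.length_append] at h2 ⊢
    omega

theorem Psi_singleton {R : Type*} [CommRing R] (h : ℕ → R) (a : ℕ) : Psi h [a] = h a := by
  simp [Psi, coarsen_singleton_iff]

/-- Split the coarsenings according to whether the first two parts are merged. -/
theorem Psi_cons_cons {R : Type*} [CommRing R] (h : ℕ → R) (a : ℕ) {a' : ℕ} (ha' : 0 < a')
    (t : List ℕ) :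
    Psi h (a :: a' :: t) = h a * Psi h (a' :: t) - Psi h ((a + a') :: t) := by
  have disj : Disjoint (List.cons a '' {b | Coarsen (a' :: t) b})
      {b | Coarsen ((a + a') :: t) b} := by
    rw [Set.disjoint_left]
    rintro _ ⟨b, -, rfl⟩ H
    obtain ⟨c, b', hb, hc⟩ := H.exists_head
    obtain ⟨rfl, -⟩ := List.cons.inj hb
    omega
  unfold Psi
  rw [setOf_coarsen_cons_cons, finsum_mem_union disj
    ((finite_setOf_coarsen_cons a' t).image _) (finite_setOf_coarsen_cons _ t),
    finsum_mem_image List.cons_injective.injOn, sub_eq_add_neg,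
    mul_finsum_mem' _ (h a) (finite_setOf_coarsen_cons a' t),
    ← finsum_mem_neg_distrib _ (finite_setOf_coarsen_cons _ t)]
  congr 1
  · refine finsum_mem_congr rfl fun b _ => ?_
    simp only [List.length_cons, List.map_cons, List.prod_cons, Nat.add_sub_add_right]
    ring
  · refine finsum_mem_congr rfl fun b hb => ?_
    have hl := Coarsen.length_le hb
    simp only [List.length_cons] at hl ⊢
    rw [Nat.sub_add_comm hl, pow_succ]
    ring

/-- The hook Schur element `s_{a,1^b}`, also allowing `a = 0`. -/
def hookSchur {R : Type*} [CommRing R] (e h : ℕ → R) (a b : ℕ) : R :=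
  ∑ j ∈ Finset.range (b + 1), (-1 : R) ^ j * e (b - j) * h (a + j)

theorem hookSchur_succ {R : Type*} [CommRing R] (e h : ℕ → R) (a b : ℕ) :
    hookSchur e h a (b + 1) = h a * e (b + 1) - hookSchur e h (a + 1) b := by
  unfold hookSchur
  rw [Finset.sum_range_succ', sub_eq_add_neg, ← Finset.sum_neg_distrib, add_comm]
  congr 1
  · simp [mul_comm]
  · refine Finset.sum_congr rfl fun j _ => ?_
    rw [Nat.add_sub_add_right, add_assoc a 1 j, add_comm 1 j, pow_succ]
    ring

theorem hookSchur_zero_left {R : Type*} [CommRing R] (e h : ℕ → R) (b : ℕ)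
    (rel : ∑ m ∈ Finset.range (b + 1), (-1 : R) ^ m * e m * h (b - m) = 0) :
    hookSchur e h 0 b = 0 := by
  rw [← mul_zero ((-1 : R) ^ b), ← rel, hookSchur, ← Finset.sum_range_reflect, Finset.mul_sum]
  refine Finset.sum_congr rfl fun j hj => ?_
  obtain ⟨i, rfl⟩ := Nat.exists_eq_add_of_le (Finset.mem_range_succ_iff.1 hj)
  have h1 : j + i + 1 - 1 - j = i := by omega
  have h2 : j + i - i = j := by omega
  have h3 : j + i - j = i := by omega
  have h4 : ((-1 : R) ^ j) * (-1) ^ j = 1 := by rw [← mul_pow]; simp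
  rw [h1, h2, h3, zero_add, pow_add]
  linear_combination (-(-1 : R) ^ i * e j * h i) * h4

theorem hookSchur_one_left {R : Type*} [CommRing R] (e h : ℕ → R) (hh0 : h 0 = 1) (b : ℕ)
    (rel : ∑ m ∈ Finset.range (b + 1 + 1), (-1 : R) ^ m * e m * h (b + 1 - m) = 0) :
    hookSchur e h 1 b = e (b + 1) := by
  have H := hookSchur_succ e h 0 b
  rw [hookSchur_zero_left e h _ rel, hh0] at H
  linear_combination H

theorem Psi_cons_replicate_one {R : Type*} [CommRing R] (e h : ℕ → R)
    (he0 : e 0 = 1) (hh0 : h 0 = 1)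
    (rel : ∀ j : ℕ, 1 ≤ j →
      ∑ m ∈ Finset.range (j + 1), (-1 : R) ^ m * e m * h (j - m) = 0)
    (a b : ℕ) : Psi h (a :: List.replicate b 1) = hookSchur e h a b := by
  induction b generalizing a with
  | zero => simp [Psi_singleton, hookSchur, he0]
  | succ b ih =>
    rw [List.replicate_succ, Psi_cons_cons h a one_pos, ih, ih, hookSchur_succ,
      hookSchur_one_left e h hh0 b (rel _ (by omega))]

/-- For the hook composition `a = (k+1, 1, …, 1)` of `n` (with `n − k − 1` parts
equal to `1`), `Ψ(a)` equals the hook Schur element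
`s_{k+1,1^{n−k−1}} = Σ_{j=0}^{n−k−1} (−1)^j e_{n−k−1−j} h_{k+1+j}`. -/
theorem Psi_hook {R : Type*} [CommRing R] (e h : ℕ → R)
    (he0 : e 0 = 1) (hh0 : h 0 = 1)
    (rel : ∀ j : ℕ, 1 ≤ j →
      ∑ m ∈ Finset.range (j + 1), (-1 : R) ^ m * e m * h (j - m) = 0)
    (n k : ℕ) (hn : 1 ≤ n) (hk : k ≤ n - 1) :
    Psi h ((k + 1) :: List.replicate (n - k - 1) 1) =
      ∑ j ∈ Finset.range (n - k - 1 + 1),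
        (-1 : R) ^ j * e (n - k - 1 - j) * h (k + 1 + j) := by
  exact Psi_cons_replicate_one e h he0 hh0 rel (k + 1) (n - k - 1)
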